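/- arXiv:1410.0939 — 2 statements merged into one kernel-verified Lean document; each statement's English description precedes it below -/
import Mathlib

section
/- Fix k ≥ 1. Let μ_n denote the Haar probability measure on the group U(n) of n×n complex unitary matrices. Then the pushforward of μ_n under the map U ↦ (Tr U, Tr(U²)/√2, …, Tr(U^k)/√k) ∈ ℂ^k converges weakly, as n → ∞, to the joint law of (Z_1,…,Z_k), where Z_1,…,Z_k are independent standard complex Gaussians. -/
open MeasureTheory Filter

noncomputable section

/-- Joint law of `k` i.i.d. standard complex Gaussians `Z = A + iB` with `A, B`
independent real centered Gaussians of variance `1/2`. -/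
def gaussPi (k : ℕ) : Measure (Fin k → ℂ) :=
  Measure.map (fun x : Fin k → ℝ × ℝ => fun i => ((x i).1 : ℂ) + (x i).2 * Complex.I)
    (Measure.pi fun _ : Fin k =>
      (ProbabilityTheory.gaussianReal 0 (1/2)).prod (ProbabilityTheory.gaussianReal 0 (1/2)))

namespace DS

open scoped Matrix

/-- The unitary group. -/
abbrev G (n : ℕ) := Matrix.unitaryGroup (Fin n) ℂ

instance compactG (n : ℕ) : CompactSpace (G n) := by
  have hK : IsCompact (Set.pi Set.univ (fun _ : Fin n => Set.pi Set.univ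
      (fun _ : Fin n => Metric.closedBall (0 : ℂ) 1))) :=
    isCompact_univ_pi fun _ => isCompact_univ_pi fun _ => isCompact_closedBall _ _
  have hc : IsClosed ((Matrix.unitaryGroup (Fin n) ℂ : Set (Matrix (Fin n) (Fin n) ℂ))) := by
    have : ((Matrix.unitaryGroup (Fin n) ℂ : Set (Matrix (Fin n) (Fin n) ℂ)))
        = {A | A * star A = 1} := by
      ext A
      simp [Matrix.mem_unitaryGroup_iff]
    rw [this]
    exact isClosed_eq (by fun_prop) continuous_const
  have : IsCompact ((Matrix.unitaryGroup (Fin n) ℂ : Set (Matrix (Fin n) (Fin n) ℂ))) := by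
    refine hK.of_isClosed_subset hc ?_
    intro A hA i _ j _
    simpa using entry_norm_bound_of_unitary hA i j
  exact isCompact_iff_compactSpace.mp this

/-- The one-parameter group `exp (s X)`. -/
def g {n : ℕ} (X : Matrix (Fin n) (Fin n) ℂ) (hX : Xᴴ = -X) (s : ℝ) : G n :=
  ⟨NormedSpace.exp (s • X), by
    rw [Matrix.mem_unitaryGroup_iff, Matrix.star_eq_conjTranspose, ← Matrix.exp_conjTranspose,
      ← Matrix.exp_add_of_commute]
    · simp [Matrix.conjTranspose_smul, hX]
    · simp [Matrix.conjTranspose_smul, hX]⟩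

lemma g_add {n : ℕ} (X : Matrix (Fin n) (Fin n) ℂ) (hX : Xᴴ = -X) (s t : ℝ) :
    g X hX (s + t) = g X hX s * g X hX t := by
  apply Subtype.ext
  simp only [g, add_smul, Submonoid.coe_mul]
  rw [Matrix.exp_add_of_commute]
  exact ((Commute.refl X).smul_left s).smul_right t

lemma g_zero {n : ℕ} (X : Matrix (Fin n) (Fin n) ℂ) (hX : Xᴴ = -X) : g X hX 0 = 1 := by
  apply Subtype.ext
  simp [g]

section
open scoped Matrix.Norms.Operator
lemma hasDerivAt_exp_entry {n : ℕ} (X : Matrix (Fin n) (Fin n) ℂ) (a b : Fin n) :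
    HasDerivAt (fun s : ℝ => (NormedSpace.exp (s • X) : Matrix (Fin n) (Fin n) ℂ) a b) (X a b) 0 := by
  have h := hasDerivAt_exp_smul_const (𝕂 := ℝ) X 0
  have h1 := hasDerivAt_pi.1 (hasDerivAt_pi.1 h a) b
  rw [zero_smul, NormedSpace.exp_zero, one_mul] at h1
  exact h1
end

lemma hasDerivAt_gU {n : ℕ} (X : Matrix (Fin n) (Fin n) ℂ) (hX : Xᴴ = -X) (U : G n)
    (a b : Fin n) :
    HasDerivAt (fun s : ℝ => ((g X hX s * U : G n) : Matrix (Fin n) (Fin n) ℂ) a b)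
      ((X * (U : Matrix (Fin n) (Fin n) ℂ)) a b) 0 := by
  simp only [Submonoid.coe_mul, Matrix.mul_apply, g]
  exact HasDerivAt.fun_sum fun c _ => (hasDerivAt_exp_entry X a c).mul_const _

lemma hasDerivAt_pow {n : ℕ} (X : Matrix (Fin n) (Fin n) ℂ) (hX : Xᴴ = -X) (U : G n) (m : ℕ) :
    ∀ (a b : Fin n),
    HasDerivAt (fun s : ℝ => ((((g X hX s * U : G n) : Matrix (Fin n) (Fin n) ℂ)) ^ m) a b)
      ((∑ l ∈ Finset.range m, (U : Matrix (Fin n) (Fin n) ℂ) ^ l * X *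
        (U : Matrix (Fin n) (Fin n) ℂ) ^ (m - l)) a b) 0 := by
  induction m with
  | zero => intro a b; simpa using hasDerivAt_const (0 : ℝ) ((1 : Matrix (Fin n) (Fin n) ℂ) a b)
  | succ m ih =>
    intro a b
    have key : (∑ l ∈ Finset.range (m + 1), (U : Matrix (Fin n) (Fin n) ℂ) ^ l * X *
        (U : Matrix (Fin n) (Fin n) ℂ) ^ (m + 1 - l)) =
        (∑ l ∈ Finset.range m, (U : Matrix (Fin n) (Fin n) ℂ) ^ l * X *
        (U : Matrix (Fin n) (Fin n) ℂ) ^ (m - l)) * (U : Matrix (Fin n) (Fin n) ℂ) +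
        (U : Matrix (Fin n) (Fin n) ℂ) ^ m * (X * (U : Matrix (Fin n) (Fin n) ℂ)) := by
      rw [Finset.sum_range_succ, Finset.sum_mul]
      congr 1
      · refine Finset.sum_congr rfl fun l hl => ?_
        have : m + 1 - l = (m - l) + 1 := by have := Finset.mem_range.1 hl; omega
        rw [this, pow_succ]; simp only [mul_assoc]
      · simp [mul_assoc]
    rw [key]
    have e1 : (fun s : ℝ => ((((g X hX s * U : G n) : Matrix (Fin n) (Fin n) ℂ)) ^ (m + 1)) a b) =
        fun s : ℝ => ∑ c, ((((g X hX s * U : G n) : Matrix (Fin n) (Fin n) ℂ)) ^ m) a c *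
          ((g X hX s * U : G n) : Matrix (Fin n) (Fin n) ℂ) c b := by
      funext s
      rw [pow_succ, Matrix.mul_apply]
    rw [e1, Matrix.add_apply, Matrix.mul_apply, Matrix.mul_apply, ← Finset.sum_add_distrib]
    refine HasDerivAt.fun_sum fun c _ => ?_
    have := (ih a c).fun_mul (hasDerivAt_gU X hX U c b)
    simpa [g_zero] using this

/-- Power sums. -/
def p {n : ℕ} (U : G n) (m : ℕ) : ℂ := Matrix.trace ((U : Matrix (Fin n) (Fin n) ℂ) ^ m)

lemma continuous_coe {n : ℕ} : Continuous (fun U : G n => (U : Matrix (Fin n) (Fin n) ℂ)) :=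
  continuous_subtype_val

@[fun_prop]
lemma continuous_p {n : ℕ} (m : ℕ) : Continuous (fun U : G n => p U m) := by
  unfold p
  exact (continuous_coe.pow m).matrix_trace

lemma p_zero {n : ℕ} (U : G n) : p U 0 = n := by simp [p]

lemma norm_p_le {n : ℕ} (U : G n) (m : ℕ) : ‖p U m‖ ≤ n := by
  unfold p Matrix.trace
  refine (norm_sum_le _ _).trans ?_
  have : ∀ i : Fin n, ‖((U : Matrix (Fin n) (Fin n) ℂ) ^ m).diag i‖ ≤ 1 := fun i =>
    entry_norm_bound_of_unitary (U ^ m).2 i i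
  calc _ ≤ ∑ i : Fin n, (1 : ℝ) := Finset.sum_le_sum fun i _ => this i
    _ = n := by simp

lemma hasDerivAt_p {n : ℕ} (X : Matrix (Fin n) (Fin n) ℂ) (hX : Xᴴ = -X) (U : G n) (m : ℕ) :
    HasDerivAt (fun s : ℝ => p (g X hX s * U) m)
      (m * Matrix.trace (X * (U : Matrix (Fin n) (Fin n) ℂ) ^ m)) 0 := by
  have h := HasDerivAt.fun_sum (u := Finset.univ) fun (a : Fin n) _ => hasDerivAt_pow X hX U m a a
  have e : (m * Matrix.trace (X * (U : Matrix (Fin n) (Fin n) ℂ) ^ m)) =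
      Matrix.trace (∑ l ∈ Finset.range m, (U : Matrix (Fin n) (Fin n) ℂ) ^ l * X *
        (U : Matrix (Fin n) (Fin n) ℂ) ^ (m - l)) := by
    rw [Matrix.trace_sum, Finset.sum_congr rfl (g := fun _ =>
      Matrix.trace (X * (U : Matrix (Fin n) (Fin n) ℂ) ^ m))]
    · simp
    · intro l hl
      rw [mul_assoc, Matrix.trace_mul_comm, mul_assoc, ← pow_add]
      congr 3
      have := Finset.mem_range.1 hl; omega
  rw [e]
  exact h

lemma hasDerivAt_star_p {n : ℕ} (X : Matrix (Fin n) (Fin n) ℂ) (hX : Xᴴ = -X) (U : G n) (m : ℕ) :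
    HasDerivAt (fun s : ℝ => star (p (g X hX s * U) m))
      (-(m * Matrix.trace (X * ((U : Matrix (Fin n) (Fin n) ℂ)ᴴ) ^ m))) 0 := by
  have h := (hasDerivAt_p X hX U m).star
  suffices e : star (m * Matrix.trace (X * (U : Matrix (Fin n) (Fin n) ℂ) ^ m)) =
      (-(m * Matrix.trace (X * ((U : Matrix (Fin n) (Fin n) ℂ)ᴴ) ^ m))) by
    rw [e] at h
    exact h
  rw [star_mul, ← Matrix.trace_conjTranspose, Matrix.conjTranspose_mul, hX,
    Matrix.conjTranspose_pow]
  rw [mul_neg, Matrix.trace_neg, Matrix.trace_mul_comm]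
  simp [mul_comm]

section ibp
variable {n : ℕ} [MeasurableSpace (G n)] [BorelSpace (G n)] (μ : Measure (G n))
  [IsProbabilityMeasure μ]

lemma integrable_of_cont {E : Type*} [NormedAddCommGroup E] {F : G n → E} (hF : Continuous F) :
    Integrable F μ :=
  hF.integrable_of_hasCompactSupport (HasCompactSupport.of_compactSpace F)

variable [μ.IsMulLeftInvariant]

lemma ibp (X : Matrix (Fin n) (Fin n) ℂ) (hX : Xᴴ = -X) (F D : G n → ℂ)
    (hF : Continuous F) (hD : Continuous D)
    (hder : ∀ U, HasDerivAt (fun s : ℝ => F (g X hX s * U)) (D U) 0) :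
    ∫ U, D U ∂μ = 0 := by
  obtain ⟨C, hC⟩ := (isCompact_univ (X := G n)).exists_bound_of_continuousOn hD.continuousOn
  have hd : ∀ U s, HasDerivAt (fun s : ℝ => F (g X hX s * U)) (D (g X hX s * U)) s := by
    intro U s
    have h := hder (g X hX s * U)
    have h2 : HasDerivAt (fun t : ℝ => F (g X hX (t - s) * (g X hX s * U)))
        (D (g X hX s * U)) s := by
      have h' : HasDerivAt (fun t : ℝ => F (g X hX t * (g X hX s * U)))
        (D (g X hX s * U)) (s - s) := by rwa [sub_self]
      exact h'.comp_sub_const s s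
    convert h2 using 2 with t
    rw [← mul_assoc, ← g_add, sub_add_cancel]
  have := hasDerivAt_integral_of_dominated_loc_of_deriv_le (μ := μ) (𝕜 := ℝ)
    (F := fun s U => F (g X hX s * U)) (F' := fun s U => D (g X hX s * U)) (x₀ := 0)
    (s := Set.univ) (bound := fun _ => C) univ_mem
    (Eventually.of_forall fun s => (hF.comp (continuous_const_mul _)).aestronglyMeasurable)
    (integrable_of_cont μ (hF.comp (continuous_const_mul _)))
    ((hD.comp (continuous_const_mul _)).aestronglyMeasurable)
    (ae_of_all _ fun U s _ => hC _ (Set.mem_univ _)) (integrable_const _)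
    (ae_of_all _ fun U s _ => hd U s)
  have h2 := this.2
  simp only [integral_mul_left_eq_self, g_zero, one_mul] at h2
  exact h2.unique (hasDerivAt_const _ _)

end ibp

lemma eq_zero_of_skew {n : ℕ} (L : Matrix (Fin n) (Fin n) ℂ →ₗ[ℂ] ℂ)
    (h : ∀ X : Matrix (Fin n) (Fin n) ℂ, Xᴴ = -X → L X = 0) (X : Matrix (Fin n) (Fin n) ℂ) :
    L X = 0 := by
  have h1 : L (X - Xᴴ) = 0 := h _ (by simp)
  have h2 : L (Complex.I • (X + Xᴴ)) = 0 := h _ (by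
    rw [Matrix.conjTranspose_smul, Matrix.conjTranspose_add, Matrix.conjTranspose_conjTranspose,
      add_comm, ← neg_smul]
    simp)
  rw [map_smul, smul_eq_mul, mul_eq_zero] at h2
  have h3 : L (X + Xᴴ) = 0 := h2.resolve_left Complex.I_ne_zero
  have h4 : (2 : ℂ) • L X = 0 := by
    rw [← map_smul, two_smul]
    have : X + X = (X - Xᴴ) + (X + Xᴴ) := by abel
    rw [this, map_add, h1, h3, add_zero]
  simpa using h4

lemma mul_single_mul {n : ℕ} (M N : Matrix (Fin n) (Fin n) ℂ) (a b x y : Fin n) :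
    (M * Matrix.single a b (1 : ℂ) * N) x y = M x a * N b y := by
  rw [Matrix.mul_apply, Finset.sum_eq_single b]
  · rw [Matrix.mul_single_apply_same]; simp
  · intro c _ hc
    rw [Matrix.mul_single_apply_of_ne _ _ _ _ _ hc, zero_mul]
  · simp

section loop
variable {n : ℕ} [MeasurableSpace (G n)] [BorelSpace (G n)] (μ : Measure (G n))
  [IsProbabilityMeasure μ] [μ.IsMulLeftInvariant]

lemma loop_entry (m : ℕ) (f : G n → ℂ) (W : G n → Matrix (Fin n) (Fin n) ℂ)
    (hf : Continuous f) (hW : Continuous W)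
    (hder : ∀ X (hX : Xᴴ = -X) U, HasDerivAt (fun s : ℝ => f (g X hX s * U))
      (Matrix.trace (X * W U)) 0) (a b : Fin n) (X : Matrix (Fin n) (Fin n) ℂ) :
    ∫ U : G n, ((∑ l ∈ Finset.range m, (U : Matrix (Fin n) (Fin n) ℂ) ^ l * X *
        (U : Matrix (Fin n) (Fin n) ℂ) ^ (m - l)) a b * f U +
        ((U : Matrix (Fin n) (Fin n) ℂ) ^ m) a b * Matrix.trace (X * W U)) ∂μ = 0 := by
  have hc := continuous_coe (n := n)
  have hcont : ∀ X : Matrix (Fin n) (Fin n) ℂ, Continuous fun U : G n =>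
      ((∑ l ∈ Finset.range m, (U : Matrix (Fin n) (Fin n) ℂ) ^ l * X *
        (U : Matrix (Fin n) (Fin n) ℂ) ^ (m - l)) a b * f U +
        ((U : Matrix (Fin n) (Fin n) ℂ) ^ m) a b * Matrix.trace (X * W U)) := by
    intro X
    refine Continuous.add (Continuous.mul ?_ hf) (Continuous.mul ?_ ?_)
    · exact Continuous.matrix_elem (continuous_finsetSum _ fun l _ =>
        ((hc.pow l).mul continuous_const).mul (hc.pow _)) a b
    · exact Continuous.matrix_elem (hc.pow m) a b
    · exact (continuous_const.mul hW).matrix_trace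
  let L : Matrix (Fin n) (Fin n) ℂ →ₗ[ℂ] ℂ :=
    { toFun := fun X => ∫ U : G n, ((∑ l ∈ Finset.range m, (U : Matrix (Fin n) (Fin n) ℂ) ^ l * X *
        (U : Matrix (Fin n) (Fin n) ℂ) ^ (m - l)) a b * f U +
        ((U : Matrix (Fin n) (Fin n) ℂ) ^ m) a b * Matrix.trace (X * W U)) ∂μ
      map_add' := by
        intro X Y
        rw [← integral_add (integrable_of_cont μ (hcont X)) (integrable_of_cont μ (hcont Y))]
        congr 1
        funext U
        simp only [mul_add, add_mul, Finset.sum_add_distrib, Matrix.add_apply, Matrix.trace_add]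
        ring
      map_smul' := by
        intro c X
        rw [RingHom.id_apply, smul_eq_mul, ← integral_const_mul]
        congr 1
        funext U
        simp only [Matrix.mul_smul, Matrix.smul_mul, ← Finset.smul_sum, Matrix.smul_apply,
          Matrix.trace_smul, smul_eq_mul]
        ring }
  refine eq_zero_of_skew L ?_ X
  intro X hX
  refine ibp μ X hX (fun U => ((U : Matrix (Fin n) (Fin n) ℂ) ^ m) a b * f U) _ ?_ (hcont X) ?_
  · exact (Continuous.matrix_elem (hc.pow m) a b).mul hf
  · intro U
    have := (hasDerivAt_pow X hX U m a b).fun_mul (hder X hX U)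
    simpa only [g_zero, one_mul] using this

lemma loop (m : ℕ) (f : G n → ℂ) (W : G n → Matrix (Fin n) (Fin n) ℂ)
    (hf : Continuous f) (hW : Continuous W)
    (hder : ∀ X (hX : Xᴴ = -X) U, HasDerivAt (fun s : ℝ => f (g X hX s * U))
      (Matrix.trace (X * W U)) 0) :
    ∫ U : G n, ((∑ l ∈ Finset.range m, p U l * p U (m - l)) * f U +
      Matrix.trace ((U : Matrix (Fin n) (Fin n) ℂ) ^ m * W U)) ∂μ = 0 := by
  have hc := continuous_coe (n := n)
  have key : ∀ U : G n, ((∑ l ∈ Finset.range m, p U l * p U (m - l)) * f U +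
      Matrix.trace ((U : Matrix (Fin n) (Fin n) ℂ) ^ m * W U)) =
      ∑ a, ∑ b, ((∑ l ∈ Finset.range m, (U : Matrix (Fin n) (Fin n) ℂ) ^ l *
        Matrix.single a b (1 : ℂ) * (U : Matrix (Fin n) (Fin n) ℂ) ^ (m - l)) a b * f U +
        ((U : Matrix (Fin n) (Fin n) ℂ) ^ m) a b *
          Matrix.trace (Matrix.single a b (1 : ℂ) * W U)) := by
    intro U
    simp only [Finset.sum_add_distrib, ← Finset.sum_mul]
    congr 1
    · congr 1
      simp only [Matrix.sum_apply, mul_single_mul]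
      simp only [p, Matrix.trace, Finset.sum_mul_sum, Matrix.diag_apply]
      rw [Finset.sum_comm]
      refine Finset.sum_congr rfl fun a _ => ?_
      rw [Finset.sum_comm]
    · simp only [Matrix.trace_single_mul]
      simp only [Matrix.trace, Matrix.diag_apply, Matrix.mul_apply]
      simp
  simp only [key]
  rw [integral_finsetSum]
  · refine Finset.sum_eq_zero fun a _ => ?_
    rw [integral_finsetSum]
    · exact Finset.sum_eq_zero fun b _ => loop_entry μ m f W hf hW hder a b _
    · intro b _
      refine integrable_of_cont μ ?_
      refine Continuous.add (Continuous.mul ?_ hf) (Continuous.mul ?_ ?_)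
      · exact Continuous.matrix_elem (continuous_finsetSum _ fun l _ =>
          ((hc.pow l).mul continuous_const).mul (hc.pow _)) a b
      · exact Continuous.matrix_elem (hc.pow m) a b
      · exact (continuous_const.mul hW).matrix_trace
  · intro a _
    refine integrable_of_cont μ (continuous_finsetSum _ fun b _ => ?_)
    refine Continuous.add (Continuous.mul ?_ hf) (Continuous.mul ?_ ?_)
    · exact Continuous.matrix_elem (continuous_finsetSum _ fun l _ =>
        ((hc.pow l).mul continuous_const).mul (hc.pow _)) a b
    · exact Continuous.matrix_elem (hc.pow m) a b
    · exact (continuous_const.mul hW).matrix_trace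

end loop

lemma coe_mul_conjTranspose {n : ℕ} (U : G n) :
    (U : Matrix (Fin n) (Fin n) ℂ) * (U : Matrix (Fin n) (Fin n) ℂ)ᴴ = 1 :=
  Matrix.mem_unitaryGroup_iff.1 U.2

lemma pow_mul_conjTranspose_pow {n : ℕ} (U : G n) (m : ℕ) :
    (U : Matrix (Fin n) (Fin n) ℂ) ^ m * ((U : Matrix (Fin n) (Fin n) ℂ)ᴴ) ^ m = 1 := by
  have := coe_mul_conjTranspose (U ^ m)
  rwa [SubmonoidClass.coe_pow, Matrix.conjTranspose_pow] at this

lemma sum_split {n : ℕ} (U : G n) (q : ℕ) : ∑ l ∈ Finset.range (q + 1), p U l * p U (q + 1 - l) =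
    ∑ l ∈ Finset.range q, p U (l + 1) * p U (q - l) + n * p U (q + 1) := by
  rw [Finset.sum_range_succ', p_zero]
  simp

section moments
variable {n : ℕ} [MeasurableSpace (G n)] [BorelSpace (G n)] (μ : Measure (G n))
  [IsProbabilityMeasure μ] [μ.IsMulLeftInvariant]

lemma second_moment_step (hn : 1 ≤ n) (q : ℕ) :
    ∫ U, ‖p U (q + 1)‖ ^ 2 ∂μ ≤ 2 * (q + 1) +
      (q + 1) * ∑ l ∈ Finset.range q, ∫ U, ‖p U (l + 1)‖ ^ 2 ∂μ := by
  have hn' : (0 : ℝ) < n := by exact_mod_cast hn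
  have h := loop μ (q + 1) (fun U => star (p U (q + 1)))
    (fun U => -(((q + 1 : ℕ) : ℂ) • ((U : Matrix (Fin n) (Fin n) ℂ)ᴴ) ^ (q + 1)))
    (by fun_prop)
    ((((continuous_coe.matrix_conjTranspose).pow (q + 1)).const_smul ((q + 1 : ℕ) : ℂ)).neg)
    (by
      intro X hX U
      have := hasDerivAt_star_p X hX U (q + 1)
      simpa [Matrix.trace_smul] using this)
  have hI : ∀ U : G n, (∑ l ∈ Finset.range (q + 1), p U l * p U (q + 1 - l)) * star (p U (q + 1)) +
      Matrix.trace ((U : Matrix (Fin n) (Fin n) ℂ) ^ (q + 1) *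
        -(((q + 1 : ℕ) : ℂ) • ((U : Matrix (Fin n) (Fin n) ℂ)ᴴ) ^ (q + 1))) =
      (∑ l ∈ Finset.range q, p U (l + 1) * p U (q - l)) * star (p U (q + 1)) +
      ((n * ‖p U (q + 1)‖ ^ 2 - (q + 1) * n : ℝ) : ℂ) := by
    intro U
    rw [sum_split, mul_neg, Matrix.mul_smul, pow_mul_conjTranspose_pow, add_mul, mul_assoc (n : ℂ)]
    have : p U (q + 1) * star (p U (q + 1)) = ((‖p U (q + 1)‖ ^ 2 : ℝ) : ℂ) := by
      rw [← Complex.normSq_eq_norm_sq]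
      exact Complex.mul_conj _
    rw [this]
    simp
    ring
  simp only [hI] at h
  have h_integrable : Integrable (fun U : G n => (∑ l ∈ Finset.range q, p U (l + 1) * p U (q - l)) *
      star (p U (q + 1)) + ((n * ‖p U (q + 1)‖ ^ 2 - (q + 1) * n : ℝ) : ℂ)) μ :=
    integrable_of_cont μ (by fun_prop)
  have hre : ∫ U : G n, ((∑ l ∈ Finset.range q, p U (l + 1) * p U (q - l)) *
      star (p U (q + 1)) + ((n * ‖p U (q + 1)‖ ^ 2 - (q + 1) * n : ℝ) : ℂ)).re ∂μ = 0 := by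
    have := integral_re h_integrable
    simp only [RCLike.re_eq_complex_re] at this
    rw [this, h]; simp
  have hlow : ∀ U : G n, n * (1 / 2 * ‖p U (q + 1)‖ ^ 2 - (q + 1) -
      (q + 1) / 2 * ∑ l ∈ Finset.range q, ‖p U (l + 1)‖ ^ 2) ≤
      ((∑ l ∈ Finset.range q, p U (l + 1) * p U (q - l)) *
      star (p U (q + 1)) + ((n * ‖p U (q + 1)‖ ^ 2 - (q + 1) * n : ℝ) : ℂ)).re := by
    intro U
    rw [Complex.add_re, Complex.ofReal_re]
    have h1 : ‖(∑ l ∈ Finset.range q, p U (l + 1) * p U (q - l)) * star (p U (q + 1))‖ ≤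
        n * (1 / 2 * ‖p U (q + 1)‖ ^ 2 +
          (q + 1) / 2 * ∑ l ∈ Finset.range q, ‖p U (l + 1)‖ ^ 2) := by
      rw [Finset.sum_mul]
      refine (norm_sum_le _ _).trans ?_
      have hq : (0 : ℝ) < q + 1 := by positivity
      have hterm : ∀ l ∈ Finset.range q, ‖p U (l + 1) * p U (q - l) * star (p U (q + 1))‖ ≤
          n * ((q + 1) / 2 * ‖p U (l + 1)‖ ^ 2 + 1 / (2 * (q + 1)) * ‖p U (q + 1)‖ ^ 2) := by
        intro l _
        rw [norm_mul, norm_mul, norm_star]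
        have ha := norm_nonneg (p U (l + 1))
        have hb := norm_nonneg (p U (q + 1))
        have hc := norm_p_le U (q - l)
        generalize ‖p U (l + 1)‖ = a at *
        generalize ‖p U (q + 1)‖ = b at *
        calc a * ‖p U (q - l)‖ * b ≤ a * n * b := by gcongr
          _ = n * (a * b) := by ring
          _ ≤ _ := by
            gcongr
            have : (q + 1) / 2 * a ^ 2 + 1 / (2 * (q + 1)) * b ^ 2 - a * b =
              1 / (2 * (q + 1)) * ((q + 1) * a - b) ^ 2 := by field_simp; ring
            have h2 : 0 ≤ 1 / (2 * ((q : ℝ) + 1)) * ((q + 1) * a - b) ^ 2 := by positivity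
            linarith
      refine (Finset.sum_le_sum hterm).trans ?_
      rw [← Finset.mul_sum, Finset.sum_add_distrib, ← Finset.mul_sum]
      refine mul_le_mul_of_nonneg_left ?_ hn'.le
      rw [add_comm]
      refine add_le_add ?_ le_rfl
      rw [Finset.sum_const, Finset.card_range, nsmul_eq_mul, ← mul_assoc]
      gcongr
      rw [mul_one_div, div_le_div_iff₀ (by positivity) (by positivity)]
      linarith
    have h2 := (abs_le.1 ((Complex.abs_re_le_norm _).trans h1)).1
    linarith
  have hmono := integral_mono (μ := μ) (integrable_of_cont μ (by fun_prop))
    (integrable_of_cont μ (by fun_prop)) hlow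
  rw [hre, integral_const_mul, integral_sub, integral_sub, integral_const_mul, integral_const_mul,
    integral_finsetSum] at hmono
  · simp only [integral_const, probReal_univ, one_smul] at hmono
    have := nonpos_of_mul_nonpos_right hmono hn'
    linarith
  all_goals try intro _ _
  all_goals exact integrable_of_cont μ (by fun_prop)

end moments

lemma second_moment (q : ℕ) : ∃ C : ℝ, ∀ (n : ℕ) [MeasurableSpace (G n)] [BorelSpace (G n)]
    (μ : Measure (G n)) [IsProbabilityMeasure μ] [μ.IsMulLeftInvariant], 1 ≤ n →
    ∫ U, ‖p U (q + 1)‖ ^ 2 ∂μ ≤ C := by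
  induction q using Nat.strong_induction_on with
  | _ q ih =>
    have : ∀ l : ℕ, ∃ C : ℝ, l < q → ∀ (n : ℕ) [MeasurableSpace (G n)] [BorelSpace (G n)]
        (μ : Measure (G n)) [IsProbabilityMeasure μ] [μ.IsMulLeftInvariant], 1 ≤ n →
        ∫ U, ‖p U (l + 1)‖ ^ 2 ∂μ ≤ C := by
      intro l
      by_cases hl : l < q
      · obtain ⟨C, hC⟩ := ih l hl
        exact ⟨C, fun _ => hC⟩
      · exact ⟨0, fun h => absurd h hl⟩
    choose C hC using this
    refine ⟨2 * (q + 1) + (q + 1) * ∑ l ∈ Finset.range q, C l, ?_⟩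
    intro n _ _ μ _ _ hn
    refine (second_moment_step μ hn q).trans ?_
    gcongr with l hl
    exact hC l (Finset.mem_range.1 hl) n μ hn

lemma moments (k : ℕ) : ∃ B : ℝ, 0 ≤ B ∧ ∀ (n : ℕ) [MeasurableSpace (G n)] [BorelSpace (G n)]
    (μ : Measure (G n)) [IsProbabilityMeasure μ] [μ.IsMulLeftInvariant], 1 ≤ n → ∀ j, 1 ≤ j → j ≤ k →
    ∫ U, ‖p U j‖ ^ 2 ∂μ ≤ B ∧ ∫ U, ‖p U j‖ ∂μ ≤ B := by
  choose C hC using second_moment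
  refine ⟨∑ q ∈ Finset.range k, (1 + |C q|), Finset.sum_nonneg fun _ _ => by positivity, ?_⟩
  intro n _ _ μ _ _ hn j hj hjk
  obtain ⟨q, rfl⟩ : ∃ q, j = q + 1 := ⟨j - 1, by omega⟩
  have h1 : 1 + |C q| ≤ ∑ q ∈ Finset.range k, (1 + |C q|) :=
    Finset.single_le_sum (f := fun q => 1 + |C q|) (fun _ _ => by positivity)
      (Finset.mem_range.2 (by omega))
  have h2 := hC q n μ hn
  have h3 : ∫ U, ‖p U (q + 1)‖ ∂μ ≤ ∫ U, (1 + ‖p U (q + 1)‖ ^ 2) ∂μ := by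
    refine integral_mono (integrable_of_cont μ (by fun_prop)) (integrable_of_cont μ (by fun_prop)) ?_
    intro U
    have := norm_nonneg (p U (q + 1))
    show ‖p U (q + 1)‖ ≤ 1 + ‖p U (q + 1)‖ ^ 2
    nlinarith [sq_nonneg (‖p U (q + 1)‖ - 1)]
  rw [integral_add (integrable_const _) (integrable_of_cont μ (by fun_prop))] at h3
  simp only [integral_const, probReal_univ, one_smul] at h3
  have := le_abs_self (C q)
  constructor <;> linarith

/-- The real linear statistic `∑ Re (c_j p_{j+1})`. -/
def R {n : ℕ} (k : ℕ) (c : ℕ → ℂ) (U : G n) : ℝ :=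
  ∑ j ∈ Finset.range k, (c j * p U (j + 1)).re

/-- Its exponential. -/
def f {n : ℕ} (k : ℕ) (c : ℕ → ℂ) (s : ℝ) (U : G n) : ℂ :=
  Complex.exp ((s : ℂ) * ((R k c U : ℝ) : ℂ) * Complex.I)

/-- The gradient of twice the linear statistic. -/
def Q {n : ℕ} (k : ℕ) (c : ℕ → ℂ) (U : G n) : Matrix (Fin n) (Fin n) ℂ :=
  ∑ j ∈ Finset.range k, ((j + 1 : ℕ) : ℂ) • (c j • (U : Matrix (Fin n) (Fin n) ℂ) ^ (j + 1) -
    star (c j) • ((U : Matrix (Fin n) (Fin n) ℂ)ᴴ) ^ (j + 1))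

@[fun_prop]
lemma continuous_R {n : ℕ} (k : ℕ) (c : ℕ → ℂ) : Continuous (fun U : G n => R k c U) := by
  unfold R
  fun_prop

@[fun_prop]
lemma continuous_f {n : ℕ} (k : ℕ) (c : ℕ → ℂ) (s : ℝ) : Continuous (fun U : G n => f k c s U) := by
  unfold f
  fun_prop

lemma continuous_Q {n : ℕ} (k : ℕ) (c : ℕ → ℂ) : Continuous (fun U : G n => Q k c U) := by
  unfold Q
  refine continuous_finsetSum _ fun j _ => ?_
  have h1 : Continuous fun U : G n => c j • (U : Matrix (Fin n) (Fin n) ℂ) ^ (j + 1) :=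
    (continuous_coe.pow (j + 1)).const_smul (c j)
  have h2 : Continuous fun U : G n => star (c j) • ((U : Matrix (Fin n) (Fin n) ℂ)ᴴ) ^ (j + 1) :=
    (continuous_coe.matrix_conjTranspose.pow (j + 1)).const_smul (star (c j))
  have h : Continuous fun U : G n => c j • (U : Matrix (Fin n) (Fin n) ℂ) ^ (j + 1) -
      star (c j) • ((U : Matrix (Fin n) (Fin n) ℂ)ᴴ) ^ (j + 1) := h1.sub h2
  exact h.const_smul (((j + 1 : ℕ) : ℂ))

lemma norm_f {n : ℕ} (k : ℕ) (c : ℕ → ℂ) (s : ℝ) (U : G n) : ‖f k c s U‖ = 1 := by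
  unfold f
  rw [← Complex.ofReal_mul]
  exact Complex.norm_exp_ofReal_mul_I _

lemma star_f {n : ℕ} (k : ℕ) (c : ℕ → ℂ) (s : ℝ) (U : G n) : star (f k c s U) = f k c (-s) U := by
  unfold f
  rw [Complex.star_def, ← Complex.exp_conj]
  simp

lemma R_eq {n : ℕ} (k : ℕ) (c : ℕ → ℂ) (U : G n) : ((R k c U : ℝ) : ℂ) =
    ∑ j ∈ Finset.range k, (1 / 2 : ℂ) * (c j * p U (j + 1) + star (c j) * star (p U (j + 1))) := by
  unfold R
  rw [Complex.ofReal_sum]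
  refine Finset.sum_congr rfl fun j _ => ?_
  rw [Complex.re_eq_add_conj, map_mul]
  simp only [Complex.star_def]
  ring

lemma hasDerivAt_R {n : ℕ} (k : ℕ) (c : ℕ → ℂ) (X : Matrix (Fin n) (Fin n) ℂ) (hX : Xᴴ = -X)
    (U : G n) : HasDerivAt (fun s : ℝ => ((R k c (g X hX s * U) : ℝ) : ℂ))
      (1 / 2 * Matrix.trace (X * Q k c U)) 0 := by
  simp only [R_eq]
  have e : 1 / 2 * Matrix.trace (X * Q k c U) = ∑ j ∈ Finset.range k, (1 / 2 : ℂ) *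
      (c j * (((j + 1 : ℕ) : ℂ) * Matrix.trace (X * (U : Matrix (Fin n) (Fin n) ℂ) ^ (j + 1))) +
      star (c j) * (-(((j + 1 : ℕ) : ℂ) *
        Matrix.trace (X * ((U : Matrix (Fin n) (Fin n) ℂ)ᴴ) ^ (j + 1))))) := by
    unfold Q
    rw [Finset.mul_sum, Matrix.trace_sum, Finset.mul_sum]
    refine Finset.sum_congr rfl fun j _ => ?_
    simp only [Matrix.mul_smul, Matrix.trace_smul, mul_sub, Matrix.trace_sub, smul_eq_mul]
    ring
  rw [e]
  refine HasDerivAt.fun_sum fun j _ => HasDerivAt.const_mul _ (HasDerivAt.fun_add ?_ ?_)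
  · exact (hasDerivAt_p X hX U (j + 1)).const_mul _
  · exact (hasDerivAt_star_p X hX U (j + 1)).const_mul _

lemma hasDerivAt_f {n : ℕ} (k : ℕ) (c : ℕ → ℂ) (s : ℝ) (X : Matrix (Fin n) (Fin n) ℂ)
    (hX : Xᴴ = -X) (U : G n) : HasDerivAt (fun t : ℝ => f k c s (g X hX t * U))
      (Matrix.trace (X * ((f k c s U * (Complex.I * s / 2)) • Q k c U))) 0 := by
  unfold f
  have h := (((hasDerivAt_R k c X hX U).const_mul (s : ℂ)).mul_const Complex.I).cexp
  have e : Matrix.trace (X * ((Complex.exp ((s : ℂ) * ((R k c U : ℝ) : ℂ) * Complex.I) *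
      (Complex.I * s / 2)) • Q k c U)) =
      Complex.exp ((s : ℂ) * ((R k c (g X hX 0 * U) : ℝ) : ℂ) * Complex.I) *
      ((s : ℂ) * (1 / 2 * Matrix.trace (X * Q k c U)) * Complex.I) := by
    rw [g_zero, one_mul, Matrix.mul_smul, Matrix.trace_smul, smul_eq_mul]
    ring
  rw [e]
  exact h

/-- Mixed traces, with the diagonal term removed. -/
def T {n : ℕ} (q j : ℕ) (U : G n) : ℂ :=
  if j = q then 0 else Matrix.trace ((U : Matrix (Fin n) (Fin n) ℂ) ^ (q + 1) *
    ((U : Matrix (Fin n) (Fin n) ℂ)ᴴ) ^ (j + 1))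

@[fun_prop]
lemma continuous_T {n : ℕ} (q j : ℕ) : Continuous (fun U : G n => T q j U) := by
  unfold T
  split_ifs
  · exact continuous_const
  · exact ((continuous_coe.pow _).mul (continuous_coe.matrix_conjTranspose.pow _)).matrix_trace

lemma norm_T {n : ℕ} (q j k : ℕ) (hq : q < k) (hj : j < k) (hne : j ≠ q) : ∃ i, 1 ≤ i ∧ i ≤ k ∧
    ∀ U : G n, ‖T q j U‖ = ‖p U i‖ := by
  rcases lt_or_gt_of_ne hne with h | h
  · refine ⟨q - j, by omega, by omega, fun U => ?_⟩
    have : q + 1 = (q - j) + (j + 1) := by omega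
    rw [T, if_neg hne, this, pow_add, mul_assoc, pow_mul_conjTranspose_pow, mul_one]
    rfl
  · refine ⟨j - q, by omega, by omega, fun U => ?_⟩
    have : j + 1 = (q + 1) + (j - q) := by omega
    rw [T, if_neg hne, this, pow_add _ (q + 1) (j - q), ← mul_assoc, pow_mul_conjTranspose_pow, one_mul,
      ← Matrix.conjTranspose_pow, Matrix.trace_conjTranspose, norm_star]
    rfl

lemma trace_Q {n : ℕ} (k : ℕ) (c : ℕ → ℂ) (U : G n) (q : ℕ) (hq : q < k) :
    Matrix.trace ((U : Matrix (Fin n) (Fin n) ℂ) ^ (q + 1) * Q k c U) =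
    (∑ j ∈ Finset.range k, ((j + 1 : ℕ) : ℂ) * (c j * p U (q + 1 + (j + 1)) - star (c j) * T q j U))
     - ((q + 1 : ℕ) : ℂ) * star (c q) * n := by
  have h1 : ((q + 1 : ℕ) : ℂ) * star (c q) * n = ∑ j ∈ Finset.range k,
      if j = q then ((j + 1 : ℕ) : ℂ) * star (c j) * n else 0 := by
    rw [Finset.sum_ite_eq' (Finset.range k) q, if_pos (Finset.mem_range.2 hq)]
  rw [h1, ← Finset.sum_sub_distrib]
  unfold Q
  rw [Finset.mul_sum, Matrix.trace_sum]
  refine Finset.sum_congr rfl fun j _ => ?_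
  simp only [Matrix.mul_smul, Matrix.trace_smul, mul_sub, Matrix.trace_sub, smul_eq_mul, ← pow_add]
  unfold T p
  split_ifs with hjq
  · subst hjq
    rw [pow_mul_conjTranspose_pow]
    simp
    ring
  · ring

lemma approx (k : ℕ) (c : ℕ → ℂ) : ∃ K : ℝ, 0 ≤ K ∧ ∀ (n : ℕ) [MeasurableSpace (G n)]
    [BorelSpace (G n)] (μ : Measure (G n)) [IsProbabilityMeasure μ] [μ.IsMulLeftInvariant], 1 ≤ n →
    ∀ q < k, ∀ s : ℝ, |s| ≤ 1 →
    ‖∫ U, p U (q + 1) * f k c s U ∂μ -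
      Complex.I * s / 2 * (q + 1 : ℕ) * star (c q) * ∫ U, f k c s U ∂μ‖ ≤ K / n := by
  obtain ⟨B, hB0, hB⟩ := moments (2 * k)
  refine ⟨k * B + ∑ j ∈ Finset.range k, (j + 1) * ‖c j‖ * B, by positivity, ?_⟩
  intro n _ _ μ _ _ hn q hq s hs
  have hn' : (0 : ℝ) < n := by exact_mod_cast hn
  have hB := hB n μ hn
  have h := loop μ (q + 1) (f k c s) (fun U => (f k c s U * (Complex.I * s / 2)) • Q k c U)
    (continuous_f k c s) (((continuous_f k c s).mul continuous_const).smul (continuous_Q k c))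
    (fun X hX U => hasDerivAt_f k c s X hX U)
  set E : G n → ℂ := fun U => (∑ l ∈ Finset.range q, p U (l + 1) * p U (q - l)) * f k c s U +
    f k c s U * (Complex.I * s / 2) * ∑ j ∈ Finset.range k, ((j + 1 : ℕ) : ℂ) *
      (c j * p U (q + 1 + (j + 1)) - star (c j) * T q j U) with hE
  have hEc : Continuous E := by rw [hE]; fun_prop
  have hI : ∀ U : G n, (∑ l ∈ Finset.range (q + 1), p U l * p U (q + 1 - l)) * f k c s U +
      Matrix.trace ((U : Matrix (Fin n) (Fin n) ℂ) ^ (q + 1) *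
        ((f k c s U * (Complex.I * s / 2)) • Q k c U)) =
      n * (p U (q + 1) * f k c s U -
        Complex.I * s / 2 * (q + 1 : ℕ) * star (c q) * f k c s U) + E U := by
    intro U
    rw [sum_split, Matrix.mul_smul, Matrix.trace_smul, trace_Q k c U q hq, hE, smul_eq_mul]
    ring
  simp only [hI] at h
  rw [integral_add (integrable_of_cont μ (by fun_prop)) (integrable_of_cont μ hEc),
    integral_const_mul, integral_sub (integrable_of_cont μ (by fun_prop))
      (integrable_of_cont μ (by fun_prop)), integral_const_mul] at h
  rw [le_div_iff₀ hn', mul_comm]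
  have h2 := congrArg norm (eq_neg_of_add_eq_zero_left h)
  rw [norm_mul, norm_neg, Complex.norm_natCast] at h2
  rw [h2]
  set bd : G n → ℝ := fun U =>
    (∑ l ∈ Finset.range q, (1 / 2) * (‖p U (l + 1)‖ ^ 2 + ‖p U (q - l)‖ ^ 2)) +
    ∑ j ∈ Finset.range k, (j + 1) * ‖c j‖ * ((1 / 2) * (‖p U (q + 1 + (j + 1))‖ + ‖T q j U‖))
    with hbd
  have hbdc : Continuous bd := by rw [hbd]; fun_prop
  have hle : ∀ U, ‖E U‖ ≤ bd U := by
    intro U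
    rw [hE, hbd]
    refine (norm_add_le _ _).trans (add_le_add ?_ ?_)
    · rw [norm_mul, norm_f, mul_one]
      refine (norm_sum_le _ _).trans (Finset.sum_le_sum fun l _ => ?_)
      rw [norm_mul]
      nlinarith [sq_nonneg (‖p U (l + 1)‖ - ‖p U (q - l)‖)]
    · rw [norm_mul, norm_mul, norm_f, one_mul]
      have h5 : ‖Complex.I * s / 2‖ ≤ 1 / 2 := by
        simp only [norm_div, norm_mul, Complex.norm_I, one_mul, Complex.norm_real, Real.norm_eq_abs,
          Complex.norm_ofNat]
        linarith
      refine (mul_le_mul h5 (norm_sum_le _ _) (norm_nonneg _) (by norm_num)).trans ?_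
      rw [Finset.mul_sum]
      refine Finset.sum_le_sum fun j _ => ?_
      rw [norm_mul, Complex.norm_natCast]
      have h6 : ‖c j * p U (q + 1 + (j + 1)) - star (c j) * T q j U‖ ≤
          ‖c j‖ * (‖p U (q + 1 + (j + 1))‖ + ‖T q j U‖) := by
        refine (norm_sub_le _ _).trans ?_
        rw [norm_mul, norm_mul, norm_star, mul_add]
      push_cast
      calc 1 / 2 * (((j : ℝ) + 1) * ‖c j * p U (q + 1 + (j + 1)) - star (c j) * T q j U‖)
          ≤ 1 / 2 * (((j : ℝ) + 1) * (‖c j‖ * (‖p U (q + 1 + (j + 1))‖ + ‖T q j U‖))) := by gcongr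
        _ = _ := by ring
  refine (norm_integral_le_of_norm_le (integrable_of_cont μ hbdc) (ae_of_all _ hle)).trans ?_
  rw [hbd, integral_add (integrable_of_cont μ (by fun_prop)) (integrable_of_cont μ (by fun_prop)),
    integral_finsetSum _ (fun _ _ => integrable_of_cont μ (by fun_prop)),
    integral_finsetSum _ (fun _ _ => integrable_of_cont μ (by fun_prop))]
  refine add_le_add ?_ ?_
  · calc _ ≤ ∑ l ∈ Finset.range q, B := by
          refine Finset.sum_le_sum fun l hl => ?_
          have := Finset.mem_range.1 hl
          rw [integral_const_mul, integral_add (integrable_of_cont μ (by fun_prop))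
            (integrable_of_cont μ (by fun_prop))]
          have h1 := (hB (l + 1) (by omega) (by omega)).1
          have h2 := (hB (q - l) (by omega) (by omega)).1
          linarith
      _ ≤ k * B := by
          rw [Finset.sum_const, Finset.card_range, nsmul_eq_mul]
          gcongr
  · refine Finset.sum_le_sum fun j hj => ?_
    have hj := Finset.mem_range.1 hj
    rw [integral_const_mul, integral_const_mul, integral_add (integrable_of_cont μ (by fun_prop))
            (integrable_of_cont μ (by fun_prop))]
    have h1 := (hB (q + 1 + (j + 1)) (by omega) (by omega)).2
    have h2 : ∫ U, ‖T q j U‖ ∂μ ≤ B := by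
      by_cases hjq : j = q
      · simpa [T, hjq] using hB0
      · obtain ⟨i, hi1, hi2, hi⟩ := norm_T (n := n) q j k hq hj hjq
        simp only [hi]
        exact (hB i hi1 (by omega)).2
    gcongr
    linarith

lemma phi_neg {n : ℕ} [MeasurableSpace (G n)] (μ : Measure (G n)) (k : ℕ) (c : ℕ → ℂ) (s : ℝ) :
    ∫ U, f k c (-s) U ∂μ = star (∫ U, f k c s U ∂μ) := by
  simp only [← star_f]
  exact integral_conj

lemma star_A {n : ℕ} [MeasurableSpace (G n)] (μ : Measure (G n)) (k : ℕ) (c : ℕ → ℂ) (s : ℝ)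
    (m : ℕ) : ∫ U, star (p U m) * f k c s U ∂μ = star (∫ U, p U m * f k c (-s) U ∂μ) := by
  have h : ∀ U : G n, star (p U m) * f k c s U = star (p U m * f k c (-s) U) := by
    intro U
    rw [star_mul, star_f, neg_neg, mul_comm]
  simp only [h]
  exact integral_conj

lemma hasDerivAt_phi {n : ℕ} [MeasurableSpace (G n)] [BorelSpace (G n)] (μ : Measure (G n))
    [IsProbabilityMeasure μ] (k : ℕ) (c : ℕ → ℂ) (s : ℝ) :
    HasDerivAt (fun s : ℝ => ∫ U, f k c s U ∂μ)
      (∫ U, f k c s U * (((R k c U : ℝ) : ℂ) * Complex.I) ∂μ) s := by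
  obtain ⟨C, hC⟩ := (isCompact_univ (X := G n)).exists_bound_of_continuousOn
    (continuous_R k c).continuousOn
  refine (hasDerivAt_integral_of_dominated_loc_of_deriv_le (μ := μ) (𝕜 := ℝ)
    (F := fun s U => f k c s U)
    (F' := fun s U => f k c s U * (((R k c U : ℝ) : ℂ) * Complex.I)) (x₀ := s)
    (s := Set.univ) (bound := fun _ => C) univ_mem
    (Eventually.of_forall fun s => (continuous_f k c s).aestronglyMeasurable)
    (integrable_of_cont μ (by fun_prop))
    (Continuous.aestronglyMeasurable (by fun_prop))
    (ae_of_all _ fun U s _ => ?_) (integrable_const _)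
    (ae_of_all _ fun U s _ => ?_)).2
  · simpa [norm_f] using hC U (Set.mem_univ _)
  · have h := (((hasDerivAt_id (s : ℂ)).mul_const ((R k c U : ℝ) : ℂ)).mul_const
      Complex.I).cexp.comp_ofReal
    simpa [f] using h

/-- The variance. -/
def sig (k : ℕ) (c : ℕ → ℂ) : ℝ := ∑ j ∈ Finset.range k, ((j + 1 : ℕ) : ℝ) * ‖c j‖ ^ 2

lemma phi_ode (k : ℕ) (c : ℕ → ℂ) : ∃ K : ℝ, 0 ≤ K ∧ ∀ (n : ℕ) [MeasurableSpace (G n)]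
    [BorelSpace (G n)] (μ : Measure (G n)) [IsProbabilityMeasure μ] [μ.IsMulLeftInvariant], 1 ≤ n →
    ∀ s : ℝ, |s| ≤ 1 →
    ‖∫ U, f k c s U * (((R k c U : ℝ) : ℂ) * Complex.I) ∂μ +
      s / 2 * sig k c * ∫ U, f k c s U ∂μ‖ ≤ K / n := by
  obtain ⟨K, hK0, hK⟩ := approx k c
  refine ⟨∑ j ∈ Finset.range k, ‖c j‖ * K, by positivity, ?_⟩
  intro n _ _ μ _ _ hn s hs
  have hK := hK n μ hn
  set φ := ∫ U, f k c s U ∂μ with hφ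
  have e1 : ∫ U, f k c s U * (((R k c U : ℝ) : ℂ) * Complex.I) ∂μ =
      ∑ j ∈ Finset.range k, Complex.I / 2 * (c j * ∫ U, p U (j + 1) * f k c s U ∂μ +
        star (c j) * star (∫ U, p U (j + 1) * f k c (-s) U ∂μ)) := by
    have : ∀ U : G n, f k c s U * (((R k c U : ℝ) : ℂ) * Complex.I) =
        ∑ j ∈ Finset.range k, Complex.I / 2 * (c j * (p U (j + 1) * f k c s U) +
          star (c j) * (star (p U (j + 1)) * f k c s U)) := by
      intro U
      rw [R_eq, Finset.sum_mul, Finset.mul_sum]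
      refine Finset.sum_congr rfl fun j _ => ?_
      ring
    simp only [this]
    rw [integral_finsetSum _ (fun _ _ => integrable_of_cont μ (by fun_prop))]
    refine Finset.sum_congr rfl fun j _ => ?_
    rw [integral_const_mul, integral_add (integrable_of_cont μ (by fun_prop))
      (integrable_of_cont μ (by fun_prop)), integral_const_mul, integral_const_mul, star_A]
  have e2 : (s : ℂ) / 2 * sig k c * φ = ∑ j ∈ Finset.range k, -(Complex.I / 2 *
      (c j * (Complex.I * s / 2 * (j + 1 : ℕ) * star (c j) * φ) +
      star (c j) * star (Complex.I * (-s : ℝ) / 2 * (j + 1 : ℕ) * star (c j) * star φ))) := by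
    unfold sig
    rw [Complex.ofReal_sum, Finset.mul_sum, Finset.sum_mul]
    refine Finset.sum_congr rfl fun j _ => ?_
    have h1 : c j * star (c j) = ((‖c j‖ ^ 2 : ℝ) : ℂ) := by
      rw [← Complex.normSq_eq_norm_sq]
      exact Complex.mul_conj _
    rw [Complex.ofReal_mul, ← h1]
    simp only [Complex.star_def, map_mul, map_div₀, Complex.conj_I, Complex.conj_ofReal,
      Complex.conj_conj, map_natCast, map_neg, Complex.ofReal_neg, Complex.ofReal_natCast, map_ofNat]
    linear_combination (1 / 2 * ↑s * ↑(j + 1) * (c j * (starRingEnd ℂ) (c j)) * φ) *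
      (Complex.I_sq)
  rw [e1, e2, ← Finset.sum_add_distrib, Finset.sum_div]
  refine (norm_sum_le _ _).trans (Finset.sum_le_sum fun j hj => ?_)
  have hj := Finset.mem_range.1 hj
  have h1 := hK j hj s hs
  have h2 := hK j hj (-s) (by rwa [abs_neg])
  rw [phi_neg, ← hφ] at h2
  rw [← hφ] at h1
  rw [← norm_star, star_sub] at h2
  rw [← sub_eq_add_neg, ← mul_sub, norm_mul]
  have h3 : ‖Complex.I / 2‖ = 1 / 2 := by simp
  rw [h3, add_sub_add_comm, ← mul_sub, ← mul_sub]
  refine (mul_le_mul_of_nonneg_left (norm_add_le _ _) (by norm_num)).trans ?_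
  rw [norm_mul, norm_mul, norm_star]
  have h4 := mul_le_mul_of_nonneg_left h1 (norm_nonneg (c j))
  have h5 := mul_le_mul_of_nonneg_left h2 (norm_nonneg (c j))
  have h6 : ‖c j‖ * K / n = ‖c j‖ * (K / n) := by ring
  rw [h6]
  linarith

lemma charfun_bound (k : ℕ) (c : ℕ → ℂ) : ∃ K : ℝ, 0 ≤ K ∧ ∀ (n : ℕ) [MeasurableSpace (G n)]
    [BorelSpace (G n)] (μ : Measure (G n)) [IsProbabilityMeasure μ] [μ.IsMulLeftInvariant], 1 ≤ n →
    ‖∫ U, f k c 1 U ∂μ - Complex.exp (-((sig k c : ℝ) : ℂ) / 4)‖ ≤ K / n := by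
  obtain ⟨K, hK0, hK⟩ := phi_ode k c
  refine ⟨K, hK0, ?_⟩
  intro n _ _ μ _ _ hn
  have hK := hK n μ hn
  have hsig : 0 ≤ sig k c := by unfold sig; positivity
  have hd : ∀ s : ℝ, HasDerivAt (fun s : ℝ => Complex.exp ((sig k c : ℂ) / 4 * (s : ℂ) ^ 2) *
      ∫ U, f k c s U ∂μ) (Complex.exp ((sig k c : ℂ) / 4 * (s : ℂ) ^ 2) *
        (∫ U, f k c s U * (((R k c U : ℝ) : ℂ) * Complex.I) ∂μ +
      s / 2 * sig k c * ∫ U, f k c s U ∂μ)) s := by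
    intro s
    have h1 : HasDerivAt (fun s : ℝ => Complex.exp ((sig k c : ℂ) / 4 * (s : ℂ) ^ 2))
        (Complex.exp ((sig k c : ℂ) / 4 * (s : ℂ) ^ 2) * ((sig k c : ℂ) / 4 * (2 * s))) s := by
      have := ((((hasDerivAt_id (s : ℂ)).pow 2).const_mul ((sig k c : ℂ) / 4)).cexp).comp_ofReal
      simpa using this
    have h2 := h1.fun_mul (hasDerivAt_phi μ k c s)
    refine HasDerivAt.congr_deriv h2 ?_
    ring
  have hb := norm_image_sub_le_of_norm_deriv_le_segment_01'
    (C := Real.exp (sig k c / 4) * (K / n)) (fun s _ => (hd s).hasDerivWithinAt) (by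
      intro s hs
      rw [norm_mul]
      have hs1 : |s| ≤ 1 := abs_le.2 ⟨by linarith [hs.1], hs.2.le⟩
      refine mul_le_mul ?_ (hK s hs1) (norm_nonneg _) (Real.exp_pos _).le
      rw [Complex.norm_exp]
      have : ((sig k c : ℂ) / 4 * (s : ℂ) ^ 2) = ((sig k c / 4 * s ^ 2 : ℝ) : ℂ) := by push_cast; ring
      rw [this, Complex.ofReal_re]
      have : s ^ 2 ≤ 1 := by rw [← sq_abs]; nlinarith [abs_nonneg s]
      gcongr
      nlinarith)
  have h0 : ∫ U, f k c 0 U ∂μ = 1 := by simp [f]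
  rw [h0] at hb
  have e : Complex.exp ((sig k c : ℂ) / 4 * ((1 : ℝ) : ℂ) ^ 2) * ∫ U, f k c 1 U ∂μ -
      Complex.exp ((sig k c : ℂ) / 4 * ((0 : ℝ) : ℂ) ^ 2) * 1 =
      Complex.exp ((sig k c / 4 : ℝ) : ℂ) *
      (∫ U, f k c 1 U ∂μ - Complex.exp (-((sig k c : ℝ) : ℂ) / 4)) := by
    rw [mul_sub, ← Complex.exp_add]
    push_cast
    have : (sig k c : ℂ) / 4 + -(sig k c : ℂ) / 4 = 0 := by ring
    rw [this]
    simp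
  rw [e, norm_mul, Complex.norm_exp, Complex.ofReal_re] at hb
  exact le_of_mul_le_mul_left hb (Real.exp_pos _)

/-- Law of one standard complex Gaussian. -/
def gaussC : Measure ℂ :=
  Measure.map (fun x : ℝ × ℝ => (x.1 : ℂ) + x.2 * Complex.I)
    ((ProbabilityTheory.gaussianReal 0 (1/2)).prod (ProbabilityTheory.gaussianReal 0 (1/2)))

lemma measurable_toC : Measurable (fun x : ℝ × ℝ => (x.1 : ℂ) + x.2 * Complex.I) := by
  fun_prop

instance : IsProbabilityMeasure gaussC :=
  Measure.isProbabilityMeasure_map measurable_toC.aemeasurable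

lemma gaussPi_eq (k : ℕ) : gaussPi k = Measure.pi fun _ : Fin k => gaussC := by
  unfold gaussPi gaussC
  haveI : IsProbabilityMeasure (Measure.map (fun x : ℝ × ℝ => (x.1 : ℂ) + x.2 * Complex.I)
    ((ProbabilityTheory.gaussianReal 0 (1/2)).prod (ProbabilityTheory.gaussianReal 0 (1/2)))) :=
    Measure.isProbabilityMeasure_map measurable_toC.aemeasurable
  exact Measure.pi_map_pi (fun _ => measurable_toC.aemeasurable)

instance (k : ℕ) : IsProbabilityMeasure (gaussPi k) := by
  rw [gaussPi_eq]; infer_instance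

lemma charFun_gaussC (w : ℂ) :
    charFun gaussC w = Complex.exp (-((‖w‖ ^ 2 : ℝ) : ℂ) / 4) := by
  rw [charFun_apply, gaussC, integral_map measurable_toC.aemeasurable
    (Continuous.aestronglyMeasurable (by fun_prop))]
  have h : ∀ x : ℝ × ℝ, Complex.exp ((inner ℝ ((x.1 : ℂ) + x.2 * Complex.I) w : ℝ) * Complex.I) =
      Complex.exp ((w.re : ℂ) * x.1 * Complex.I) * Complex.exp ((w.im : ℂ) * x.2 * Complex.I) := by
    intro x
    rw [← Complex.exp_add]
    congr 1
    rw [Complex.inner]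
    simp
    ring
  simp only [h]
  rw [integral_prod_mul (fun x : ℝ => Complex.exp ((w.re : ℂ) * x * Complex.I))
    (fun x : ℝ => Complex.exp ((w.im : ℂ) * x * Complex.I)), ← charFun_apply_real,
    ← charFun_apply_real, ProbabilityTheory.charFun_gaussianReal,
    ProbabilityTheory.charFun_gaussianReal, ← Complex.exp_add]
  congr 1
  rw [← Complex.normSq_eq_norm_sq, Complex.normSq_apply]
  push_cast
  simp
  ring

/-- The map to `ℂ^k`. -/
def Phi (k n : ℕ) (U : G n) : Fin k → ℂ := fun j =>
  Matrix.trace ((U ^ ((j : ℕ) + 1) : Matrix.unitaryGroup (Fin n) ℂ) :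
                Matrix (Fin n) (Fin n) ℂ) / ((Real.sqrt ((j : ℕ) + 1) : ℝ) : ℂ)

lemma Phi_apply (k n : ℕ) (U : G n) (j : Fin k) :
    Phi k n U j = p U (j + 1) / ((Real.sqrt ((j : ℕ) + 1) : ℝ) : ℂ) := by
  rw [Phi, p, SubmonoidClass.coe_pow]

lemma continuous_Phi (k n : ℕ) : Continuous (Phi k n) := by
  refine continuous_pi fun j => ?_
  simp only [Phi_apply]
  fun_prop

/-- Coefficients. -/
def cc {k : ℕ} (t : PiLp 2 (fun _ : Fin k => ℂ)) (j : ℕ) : ℂ :=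
  if h : j < k then star (t ⟨j, h⟩) / ((Real.sqrt ((j : ℕ) + 1) : ℝ) : ℂ) else 0

lemma sig_cc {k : ℕ} (t : PiLp 2 (fun _ : Fin k => ℂ)) : sig k (cc t) = ∑ i, ‖t i‖ ^ 2 := by
  unfold sig
  rw [Finset.sum_range]
  refine Finset.sum_congr rfl fun j _ => ?_
  simp only [cc, j.2, dif_pos]
  rw [norm_div, norm_star, Complex.norm_real, Real.norm_eq_abs, div_pow, sq_abs, Real.sq_sqrt
    (by positivity)]
  push_cast
  field_simp

lemma R_cc {k n : ℕ} (t : PiLp 2 (fun _ : Fin k => ℂ)) (U : G n) :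
    R k (cc t) U = inner ℝ (WithLp.toLp 2 (Phi k n U)) t := by
  unfold R
  rw [Finset.sum_range, PiLp.inner_apply]
  refine Finset.sum_congr rfl fun j _ => ?_
  simp only [cc, j.2, dif_pos]
  rw [Complex.inner, Phi_apply, ← Complex.conj_re]
  congr 1
  simp only [map_mul, map_div₀, Complex.star_def, Complex.conj_conj, Complex.conj_ofReal]
  ring

lemma charFun_gauss {k : ℕ} (t : PiLp 2 (fun _ : Fin k => ℂ)) :
    charFun ((gaussPi k).map (WithLp.toLp 2)) t =
      Complex.exp (-((sig k (cc t) : ℝ) : ℂ) / 4) := by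
  rw [gaussPi_eq, charFun_pi, sig_cc]
  simp only [charFun_gaussC]
  rw [← Complex.exp_sum]
  congr 1
  push_cast
  rw [neg_div, Finset.sum_div, ← Finset.sum_neg_distrib]
  refine Finset.sum_congr rfl fun j _ => ?_
  ring

lemma charFun_trace {k n : ℕ} [MeasurableSpace (G n)] [BorelSpace (G n)] (μ : Measure (G n))
    (t : PiLp 2 (fun _ : Fin k => ℂ)) :
    charFun (μ.map (fun U => (WithLp.toLp 2 (Phi k n U) : PiLp 2 (fun _ : Fin k => ℂ)))) t =
      ∫ U, f k (cc t) 1 U ∂μ := by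
  have hc : Continuous (fun U => (WithLp.toLp 2 (Phi k n U) : PiLp 2 (fun _ : Fin k => ℂ))) :=
    (PiLp.continuous_toLp 2 _).comp (continuous_Phi k n)
  rw [charFun_apply, integral_map hc.measurable.aemeasurable
    (Continuous.aestronglyMeasurable (by fun_prop))]
  simp only [f, R_cc, Complex.ofReal_one, one_mul]

end DS

/-- Diaconis–Shahshahani. -/
theorem traces_of_haar_unitary_tendsto_complex_gaussians
    (k : ℕ) (hk : 1 ≤ k)
    (inst : ∀ n : ℕ, MeasurableSpace (Matrix.unitaryGroup (Fin n) ℂ))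
    (hborel : ∀ n, @BorelSpace _ _ (inst n))
    (μ : ∀ n, @Measure (Matrix.unitaryGroup (Fin n) ℂ) (inst n))
    (hHaar : ∀ n, @Measure.IsHaarMeasure _ _ _ (inst n) (μ n))
    (hprob : ∀ n, @IsProbabilityMeasure _ (inst n) (μ n)) :
    ∀ h : BoundedContinuousFunction (Fin k → ℂ) ℝ,
      Tendsto (fun n : ℕ =>
          ∫ U, h (fun j : Fin k =>
            Matrix.trace ((U ^ ((j : ℕ) + 1) : Matrix.unitaryGroup (Fin n) ℂ) :
                Matrix (Fin n) (Fin n) ℂ) / ((Real.sqrt ((j : ℕ) + 1) : ℝ) : ℂ)) ∂(μ n))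
        atTop (nhds (∫ z, h z ∂(gaussPi k))) := by
  intro h
  have hc : ∀ n, Continuous (fun U => (WithLp.toLp 2 (DS.Phi k n U) :
      PiLp 2 (fun _ : Fin k => ℂ))) := fun n =>
    (PiLp.continuous_toLp 2 _).comp (DS.continuous_Phi k n)
  have hc2 : Continuous (fun z : Fin k → ℂ => (WithLp.toLp 2 z : PiLp 2 (fun _ : Fin k => ℂ))) :=
    PiLp.continuous_toLp 2 _
  let ν : ℕ → ProbabilityMeasure (PiLp 2 (fun _ : Fin k => ℂ)) := fun n =>
    ⟨(μ n).map (fun U => (WithLp.toLp 2 (DS.Phi k n U) : PiLp 2 (fun _ : Fin k => ℂ))),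
      Measure.isProbabilityMeasure_map (hc n).measurable.aemeasurable⟩
  let ν₀ : ProbabilityMeasure (PiLp 2 (fun _ : Fin k => ℂ)) :=
    ⟨(gaussPi k).map (WithLp.toLp 2), Measure.isProbabilityMeasure_map hc2.measurable.aemeasurable⟩
  have hconv : Tendsto ν atTop (nhds ν₀) := by
    refine ProbabilityMeasure.tendsto_of_tendsto_charFun fun t => ?_
    obtain ⟨K, hK0, hK⟩ := DS.charfun_bound k (DS.cc t)
    rw [tendsto_iff_norm_sub_tendsto_zero]
    have hz : Tendsto (fun n : ℕ => K / (n : ℝ)) atTop (nhds 0) :=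
      tendsto_const_div_atTop_nhds_zero_nat K
    refine squeeze_zero' (Eventually.of_forall fun _ => norm_nonneg _) ?_ hz
    filter_upwards [eventually_ge_atTop 1] with n hn
    have := hK n (μ n) hn
    rw [← DS.charFun_trace, ← DS.charFun_gauss] at this
    exact this
  have hfin := (ProbabilityMeasure.tendsto_iff_forall_integral_tendsto.1 hconv)
    (h.compContinuous ⟨fun x : PiLp 2 (fun _ : Fin k => ℂ) => WithLp.ofLp x,
      PiLp.continuous_ofLp 2 _⟩)
  have e0 : ∫ x, (h.compContinuous ⟨fun x : PiLp 2 (fun _ : Fin k => ℂ) => WithLp.ofLp x,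
      PiLp.continuous_ofLp 2 _⟩) x ∂(ν₀ : Measure (PiLp 2 (fun _ : Fin k => ℂ))) =
      ∫ z, h z ∂(gaussPi k) := by
    exact integral_map hc2.measurable.aemeasurable
      (BoundedContinuousFunction.continuous _).aestronglyMeasurable
  have e1 : ∀ n, ∫ x, (h.compContinuous ⟨fun x : PiLp 2 (fun _ : Fin k => ℂ) => WithLp.ofLp x,
      PiLp.continuous_ofLp 2 _⟩) x ∂(ν n : Measure (PiLp 2 (fun _ : Fin k => ℂ))) =
      ∫ U, h (DS.Phi k n U) ∂(μ n) := by
    intro n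
    exact integral_map (hc n).measurable.aemeasurable
      (BoundedContinuousFunction.continuous _).aestronglyMeasurable
  rw [e0] at hfin
  simp only [e1] at hfin
  exact hfin

end
end

section
/- Let L : [0,2π) → ℝ be such that L ∈ L¹, e^L ∈ L¹, and L̂_0 = (1/2π) ∫_0^{2π} L(φ) dφ = 0. Then the Toeplitz determinants of e^L are increasing in n: for every n ≥ 1, D_{n−1}(e^L) ≤ D_n(e^L) (both being positive reals). -/
open MeasureTheory Filter Finset

noncomputable section

/-- Fourier coefficient `f_m = (1/2π) ∫_0^{2π} f(φ) e^{-imφ} dφ`. -/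
def fCoeff (f : ℝ → ℂ) (m : ℤ) : ℂ :=
  ((2 * Real.pi : ℝ) : ℂ)⁻¹ *
    ∫ φ in Set.Ico (0:ℝ) (2 * Real.pi), f φ * Complex.exp (-Complex.I * m * φ)

/-- The Toeplitz determinant `D_{n-1}(f)`. -/
def toeplitzDet (n : ℕ) (f : ℝ → ℂ) : ℂ :=
  Matrix.det (Matrix.of fun j k : Fin n => fCoeff f ((j : ℤ) - (k : ℤ)))

open Polynomial in
/-- Szego type lower bound. -/
theorem szego_bound (L : ℝ → ℝ)
    (hL : IntegrableOn L (Set.Ico (0:ℝ) (2 * Real.pi)))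
    (heL : IntegrableOn (fun φ => Real.exp (L φ)) (Set.Ico (0:ℝ) (2 * Real.pi)))
    (hmean : (2 * Real.pi)⁻¹ * ∫ φ in Set.Ico (0:ℝ) (2 * Real.pi), L φ = 0)
    (P : ℂ[X]) (hP : P ≠ 0) :
    ‖P.leadingCoeff‖ ^ 2 ≤ (2 * Real.pi)⁻¹ * ∫ φ in Set.Ico (0:ℝ) (2 * Real.pi),
      Real.exp (L φ) * ‖P.eval (circleMap 0 1 φ)‖ ^ 2 := by
  have hpi := Real.two_pi_pos
  set c := ‖P.leadingCoeff‖ with hc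
  have hc0 : 0 < c := by simpa [hc] using hP
  have hlogint : IntegrableOn (fun φ => Real.log ‖P.eval (circleMap 0 1 φ)‖)
      (Set.Ico (0:ℝ) (2 * Real.pi)) := by
    have := P.intervalIntegrable_mahlerMeasure
    rwa [intervalIntegrable_iff_integrableOn_Ico_of_le hpi.le] at this
  have hmahler : Real.log c ≤ (2 * Real.pi)⁻¹ *
      ∫ φ in Set.Ico (0:ℝ) (2 * Real.pi), Real.log ‖P.eval (circleMap 0 1 φ)‖ := by
    have h := P.leadingCoeff_le_mahlerMeasure
    rw [mahlerMeasure_def_of_ne_zero hP, ← Real.log_le_iff_le_exp hc0,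
      intervalIntegral.integral_of_le hpi.le, ← integral_Ico_eq_integral_Ioc] at h
    exact h
  have hcont : Continuous (fun φ : ℝ => P.eval (circleMap 0 1 φ)) :=
    P.continuous.comp (continuous_circleMap 0 1)
  have hint : IntegrableOn (fun φ => Real.exp (L φ) * ‖P.eval (circleMap 0 1 φ)‖ ^ 2)
      (Set.Ico (0:ℝ) (2 * Real.pi)) := by
    have h1 : IntegrableOn (fun φ => Real.exp (L φ)) (Set.Icc (0:ℝ) (2 * Real.pi)) :=
      (integrableOn_Icc_iff_integrableOn_Ico).mpr heL
    have hc2 : ContinuousOn (fun φ : ℝ => ‖P.eval (circleMap 0 1 φ)‖ ^ 2)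
      (Set.Icc (0:ℝ) (2 * Real.pi)) := (hcont.norm.pow 2).continuousOn
    exact (h1.mul_continuousOn hc2 isCompact_Icc).mono_set Set.Ico_subset_Icc_self
  have hfin : ({φ : ℝ | P.eval (circleMap 0 1 φ) = 0} ∩ Set.Ico (0:ℝ) (2 * Real.pi)).Finite := by
    have hinj : Set.InjOn (circleMap 0 1) (Set.Ico (0:ℝ) (2 * Real.pi)) :=
      injOn_circleMap_of_abs_sub_le' one_ne_zero (by simp)
    refine Set.Finite.of_finite_image ((P.roots.toFinset.finite_toSet).subset ?_)
      (hinj.mono Set.inter_subset_right)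
    rintro _ ⟨φ, hφ, rfl⟩
    simpa [hP] using hφ.1
  have hae : ∀ᵐ φ ∂(volume.restrict (Set.Ico (0:ℝ) (2 * Real.pi))),
      c ^ 2 * ((1 - 2 * Real.log c) + (2 * Real.log ‖P.eval (circleMap 0 1 φ)‖ + L φ)) ≤
        Real.exp (L φ) * ‖P.eval (circleMap 0 1 φ)‖ ^ 2 := by
    rw [ae_restrict_iff' measurableSet_Ico]
    have h0 := hfin.measure_zero volume
    filter_upwards [compl_mem_ae_iff.mpr h0] with φ hφ hφ2
    have hne : P.eval (circleMap 0 1 φ) ≠ 0 := fun h => hφ ⟨h, hφ2⟩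
    have hp : 0 < ‖P.eval (circleMap 0 1 φ)‖ := norm_pos_iff.mpr hne
    set r := ‖P.eval (circleMap 0 1 φ)‖
    have h := Real.add_one_le_exp (L φ + 2 * Real.log r - 2 * Real.log c)
    have e : Real.exp (L φ + 2 * Real.log r - 2 * Real.log c) =
        Real.exp (L φ) * r ^ 2 / c ^ 2 := by
      rw [Real.exp_sub, Real.exp_add, two_mul, two_mul, Real.exp_add, Real.exp_add,
        Real.exp_log hp, Real.exp_log hc0, sq, sq]
    rw [e, le_div_iff₀ (by positivity)] at h
    linarith
  have hconst : IntegrableOn (fun _ : ℝ => 1 - 2 * Real.log c) (Set.Ico (0:ℝ) (2 * Real.pi)) :=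
    integrableOn_const measure_Ico_lt_top.ne
  have hsum : IntegrableOn (fun φ => 2 * Real.log ‖P.eval (circleMap 0 1 φ)‖ + L φ)
      (Set.Ico (0:ℝ) (2 * Real.pi)) := (hlogint.const_mul 2).add hL
  have hmono := integral_mono_ae ((hconst.add hsum).const_mul (c ^ 2)) hint hae
  simp only [Pi.add_apply] at hmono
  rw [integral_const_mul, integral_add hconst hsum, integral_add (hlogint.const_mul 2) hL,
    integral_const_mul] at hmono
  have hk : ∫ _ in Set.Ico (0:ℝ) (2 * Real.pi), (1 - 2 * Real.log c) =
      2 * Real.pi * (1 - 2 * Real.log c) := by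
    simp [hpi.le]
  have hL0 : ∫ φ in Set.Ico (0:ℝ) (2 * Real.pi), L φ = 0 := by
    rcases mul_eq_zero.mp hmean with h | h
    · exact absurd h (inv_ne_zero hpi.ne')
    · exact h
  rw [hk, hL0] at hmono
  rw [inv_mul_eq_div, le_div_iff₀ hpi] at *
  refine le_trans ?_ hmono
  have : 0 ≤ c ^ 2 := by positivity
  nlinarith

/-- The polynomial with coefficient vector `x`. -/
def vecPoly {n : ℕ} (x : Fin n → ℂ) : Polynomial ℂ :=
  ∑ k, Polynomial.C (x k) * Polynomial.X ^ (k : ℕ)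

theorem vecPoly_coeff {n : ℕ} (x : Fin n → ℂ) (k : Fin n) : (vecPoly x).coeff k = x k := by
  simp [vecPoly, Polynomial.coeff_X_pow, Fin.val_inj]

theorem vecPoly_ne_zero {n : ℕ} (x : Fin n → ℂ) (hx : x ≠ 0) : vecPoly x ≠ 0 := by
  intro h
  apply hx
  ext k
  rw [← vecPoly_coeff x k, h]
  simp

theorem vecPoly_leadingCoeff {n : ℕ} (x : Fin (n + 1) → ℂ) (hx : x (Fin.last n) ≠ 0) :
    (vecPoly x).leadingCoeff = x (Fin.last n) := by
  have hdeg : (vecPoly x).natDegree = n := by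
    apply le_antisymm
    · apply Polynomial.natDegree_sum_le_of_forall_le
      intro k _
      exact (Polynomial.natDegree_C_mul_X_pow_le _ _).trans (by omega)
    · apply Polynomial.le_natDegree_of_ne_zero
      have := vecPoly_coeff x (Fin.last n)
      rw [Fin.val_last] at this
      rwa [this]
  rw [Polynomial.leadingCoeff, hdeg]
  simpa using vecPoly_coeff x (Fin.last n)

/-- The Toeplitz matrix. -/
def toepM (n : ℕ) (L : ℝ → ℝ) : Matrix (Fin n) (Fin n) ℂ :=
  Matrix.of fun j k : Fin n => fCoeff (fun φ => (Real.exp (L φ) : ℂ)) ((j : ℤ) - (k : ℤ))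

theorem toepM_form (n : ℕ) (L : ℝ → ℝ)
    (heL : IntegrableOn (fun φ => Real.exp (L φ)) (Set.Ico (0:ℝ) (2 * Real.pi)))
    (x : Fin n → ℂ) :
    star x ⬝ᵥ (toepM n L).mulVec x = (((2 * Real.pi)⁻¹ * ∫ φ in Set.Ico (0:ℝ) (2 * Real.pi),
      Real.exp (L φ) * ‖(vecPoly x).eval (circleMap 0 1 φ)‖ ^ 2 : ℝ) : ℂ) := by
  have hint : ∀ m : ℤ, IntegrableOn
      (fun φ : ℝ => (Real.exp (L φ) : ℂ) * Complex.exp (-Complex.I * m * φ))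
      (Set.Ico (0:ℝ) (2 * Real.pi)) := by
    intro m
    have h1 : IntegrableOn (fun φ => (Real.exp (L φ) : ℂ)) (Set.Icc (0:ℝ) (2 * Real.pi)) :=
      (integrableOn_Icc_iff_integrableOn_Ico).mpr heL.ofReal
    refine (h1.mul_continuousOn (g' := fun φ : ℝ => Complex.exp (-Complex.I * m * φ))
      ?_ isCompact_Icc).mono_set Set.Ico_subset_Icc_self
    exact Continuous.continuousOn (by fun_prop)
  have hpt : ∀ φ : ℝ, ((Real.exp (L φ) * ‖(vecPoly x).eval (circleMap 0 1 φ)‖ ^ 2 : ℝ) : ℂ) =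
      ∑ j, ∑ k, (star (x j) * x k) * ((Real.exp (L φ) : ℂ) *
        Complex.exp (-Complex.I * (((j : ℤ) - (k : ℤ) : ℤ) : ℂ) * φ)) := by
    intro φ
    have h1 : (vecPoly x).eval (circleMap 0 1 φ) = ∑ k, x k * Complex.exp (Complex.I * k * φ) := by
      simp only [vecPoly, Polynomial.eval_finsetSum, Polynomial.eval_mul, Polynomial.eval_C,
        Polynomial.eval_pow, Polynomial.eval_X]
      refine Finset.sum_congr rfl fun k _ => ?_
      rw [circleMap_zero, Complex.ofReal_one, one_mul, ← Complex.exp_nat_mul]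
      ring_nf
    rw [h1]
    push_cast
    rw [← Complex.conj_mul', map_sum, Finset.sum_mul_sum, Finset.mul_sum]
    refine Finset.sum_congr rfl fun j _ => ?_
    rw [Finset.mul_sum]
    refine Finset.sum_congr rfl fun k _ => ?_
    have h2 : Complex.exp (-Complex.I * ((j : ℂ) - (k : ℂ)) * φ) =
        (starRingEnd ℂ) (Complex.exp (Complex.I * j * φ)) * Complex.exp (Complex.I * k * φ) := by
      rw [← Complex.exp_conj, ← Complex.exp_add]
      simp only [map_mul, Complex.conj_I, Complex.conj_ofReal, map_natCast]
      ring_nf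
    rw [h2, map_mul]
    simp only [Complex.star_def]
    ring
  rw [Complex.ofReal_mul, ← integral_complex_ofReal]
  simp_rw [hpt]
  rw [integral_finsetSum _ fun j _ => integrable_finsetSum _ fun k _ => (hint _).const_mul _]
  simp_rw [integral_finsetSum _ fun k _ => (hint _).const_mul _]
  simp only [dotProduct, Matrix.mulVec, toepM, fCoeff, Matrix.of_apply, Finset.mul_sum,
    integral_const_mul, Pi.star_apply]
  refine Finset.sum_congr rfl fun j _ => Finset.sum_congr rfl fun k _ => ?_
  push_cast
  ring

theorem toepM_herm (n : ℕ) (L : ℝ → ℝ) : (toepM n L).IsHermitian := by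
  ext j k
  simp only [Matrix.conjTranspose_apply, toepM, Matrix.of_apply, fCoeff, Complex.star_def, map_mul,
    ← integral_conj, map_inv₀, Complex.conj_ofReal, ← Complex.exp_conj]
  congr 2
  ext φ
  simp only [map_neg, Complex.conj_I, map_intCast]
  congr 2
  push_cast
  ring

open scoped ComplexOrder in
theorem toepM_posDef (n : ℕ) (L : ℝ → ℝ)
    (hL : IntegrableOn L (Set.Ico (0:ℝ) (2 * Real.pi)))
    (heL : IntegrableOn (fun φ => Real.exp (L φ)) (Set.Ico (0:ℝ) (2 * Real.pi)))
    (hmean : (2 * Real.pi)⁻¹ * ∫ φ in Set.Ico (0:ℝ) (2 * Real.pi), L φ = 0) :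
    (toepM n L).PosDef := by
  refine Matrix.PosDef.of_dotProduct_mulVec_pos (toepM_herm n L) fun x hx => ?_
  rw [toepM_form n L heL x, Complex.zero_lt_real]
  have h0 := vecPoly_ne_zero x hx
  refine lt_of_lt_of_le ?_ (szego_bound L hL heL hmean (vecPoly x) h0)
  have : (vecPoly x).leadingCoeff ≠ 0 := by simpa using h0
  positivity

open scoped ComplexOrder in
theorem toepM_det (n : ℕ) (L : ℝ → ℝ)
    (hL : IntegrableOn L (Set.Ico (0:ℝ) (2 * Real.pi)))
    (heL : IntegrableOn (fun φ => Real.exp (L φ)) (Set.Ico (0:ℝ) (2 * Real.pi)))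
    (hmean : (2 * Real.pi)⁻¹ * ∫ φ in Set.Ico (0:ℝ) (2 * Real.pi), L φ = 0) :
    ∃ d : ℝ, 0 < d ∧ (toepM n L).det = (d : ℂ) := by
  have h := (toepM_posDef n L hL heL hmean).det_pos
  obtain ⟨h1, h2⟩ := Complex.pos_iff.mp h
  exact ⟨_, h1, Complex.ext rfl (by simp [← h2])⟩

theorem toepM_mono (n : ℕ) (L : ℝ → ℝ)
    (hL : IntegrableOn L (Set.Ico (0:ℝ) (2 * Real.pi)))
    (heL : IntegrableOn (fun φ => Real.exp (L φ)) (Set.Ico (0:ℝ) (2 * Real.pi)))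
    (hmean : (2 * Real.pi)⁻¹ * ∫ φ in Set.Ico (0:ℝ) (2 * Real.pi), L φ = 0)
    (d D : ℝ) (hd : 0 < d) (h1 : (toepM n L).det = (d : ℂ))
    (h2 : (toepM (n + 1) L).det = (D : ℂ)) : d ≤ D := by
  set y : Fin (n + 1) → ℂ := fun i => (toepM (n + 1) L).adjugate i (Fin.last n) with hy
  have hlast : y (Fin.last n) = (d : ℂ) := by
    rw [hy]
    simp only [Matrix.adjugate_fin_succ_eq_det_submatrix]
    rw [← two_mul, pow_mul, ← h1]
    simp only [even_two, Even.neg_pow, one_pow, one_mul]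
    congr 1
    ext i j
    simp [toepM]
  have hTy : (toepM (n + 1) L).mulVec y = Pi.single (Fin.last n) (D : ℂ) := by
    ext i
    have := congrFun (congrFun (Matrix.mul_adjugate (toepM (n + 1) L)) i) (Fin.last n)
    rw [Matrix.mul_apply, h2] at this
    simp only [Matrix.mulVec, dotProduct, hy]
    rw [this]
    simp [Matrix.one_apply, Pi.single_apply]
  have hform := toepM_form (n + 1) L heL y
  have hne : y (Fin.last n) ≠ 0 := by
    rw [hlast]; exact_mod_cast hd.ne'
  have hP := szego_bound L hL heL hmean (vecPoly y)
    (vecPoly_ne_zero y fun h => hne (by rw [h]; rfl))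
  rw [vecPoly_leadingCoeff y hne, hlast, Complex.norm_real, Real.norm_eq_abs, sq_abs] at hP
  rw [hTy, dotProduct_single, Pi.star_apply, hlast, Complex.star_def, Complex.conj_ofReal,
    ← Complex.ofReal_mul] at hform
  have hform' := Complex.ofReal_injective hform
  rw [← hform'] at hP
  nlinarith

/-- monotonicity of Toeplitz determinants for a mean-zero symbol. -/
theorem toeplitzDet_monotone (L : ℝ → ℝ)
    (hL : IntegrableOn L (Set.Ico (0:ℝ) (2 * Real.pi)))
    (heL : IntegrableOn (fun φ => Real.exp (L φ)) (Set.Ico (0:ℝ) (2 * Real.pi)))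
    (hmean : (2 * Real.pi)⁻¹ * ∫ φ in Set.Ico (0:ℝ) (2 * Real.pi), L φ = 0) :
    ∀ n : ℕ, 1 ≤ n →
      (toeplitzDet n (fun φ => (Real.exp (L φ) : ℂ))).im = 0 ∧
      (toeplitzDet (n + 1) (fun φ => (Real.exp (L φ) : ℂ))).im = 0 ∧
      0 < (toeplitzDet n (fun φ => (Real.exp (L φ) : ℂ))).re ∧
      0 < (toeplitzDet (n + 1) (fun φ => (Real.exp (L φ) : ℂ))).re ∧
      (toeplitzDet n (fun φ => (Real.exp (L φ) : ℂ))).re ≤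
        (toeplitzDet (n + 1) (fun φ => (Real.exp (L φ) : ℂ))).re := by
  intro n _
  obtain ⟨d, hd, h1⟩ := toepM_det n L hL heL hmean
  obtain ⟨D, hD, h2⟩ := toepM_det (n + 1) L hL heL hmean
  have hle := toepM_mono n L hL heL hmean d D hd h1 h2
  have e1 : toeplitzDet n (fun φ => (Real.exp (L φ) : ℂ)) = (d : ℂ) := h1
  have e2 : toeplitzDet (n + 1) (fun φ => (Real.exp (L φ) : ℂ)) = (D : ℂ) := h2
  rw [e1, e2]
  exact ⟨Complex.ofReal_im _, Complex.ofReal_im _, hd, hD, hle⟩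

end
end
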